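/- Let u₀ : ℝ → ℝ be bounded and continuous, 1 ≤ p < ∞, and K ⊆ ℝ² compact. Define the approximate solutions U^{(N)}(ω; t, x) = u₀(Γ^{(N)}(ω; 0; x, t)) and the limit U(ω; t, x) = u₀(Γ(ω; 0; x, t)). Then U^{(N)} → U pointwise (P ⊗ λ)-almost everywhere on Ω × ℝ², and the expected L^p-distance on K converges to zero: E^P[ ‖U^{(N)}(ω; ·, ·) − U(ω; ·, ·)‖_{L^p(K)} ] → 0 as N → ∞. -/

import Mathlib

open Filter Topology MeasureTheory Set

/-- Generalized inverse: `geninv f x = inf {t : f t ≥ x}`. -/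
noncomputable def geninv (f : ℝ → ℝ) (x : ℝ) : ℝ := sInf {t : ℝ | x ≤ f t}

/-- Piecewise affine interpolation of `ξ` through the dyadic grid points
`(k/2^N, ξ(k/2^N))`, `k ∈ ℤ`. -/
noncomputable def dyadicInterp (ξ : ℝ → ℝ) (N : ℕ) (s : ℝ) : ℝ :=
  (((⌈s * 2 ^ N⌉ : ℤ) : ℝ) / 2 ^ N - s) * 2 ^ N
      * ξ ((((⌈s * 2 ^ N⌉ : ℤ) : ℝ) - 1) / 2 ^ N)
    + (1 - (((⌈s * 2 ^ N⌉ : ℤ) : ℝ) / 2 ^ N - s) * 2 ^ N)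
      * ξ (((⌈s * 2 ^ N⌉ : ℤ) : ℝ) / 2 ^ N)

theorem dyadicInterp_mem_Icc_grid {f : ℝ → ℝ} (hf : Monotone f) (N : ℕ) (s : ℝ) :
    dyadicInterp f N s ∈ Icc (f ((((⌈s * 2 ^ N⌉ : ℤ) : ℝ) - 1) / 2 ^ N))
      (f (((⌈s * 2 ^ N⌉ : ℤ) : ℝ) / 2 ^ N)) := by
  unfold dyadicInterp
  have h2 : (0 : ℝ) < 2 ^ N := by positivity
  have h1 := Int.le_ceil (s * 2 ^ N)
  have h3 := Int.ceil_lt_add_one (s * 2 ^ N)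
  generalize ((⌈s * 2 ^ N⌉ : ℤ) : ℝ) = k at *
  have hθ : (k / 2 ^ N - s) * 2 ^ N = k - s * 2 ^ N := by field_simp
  rw [hθ]
  have hab : f ((k - 1) / 2 ^ N) ≤ f (k / 2 ^ N) :=
    hf (by gcongr; linarith)
  constructor <;> nlinarith

theorem dyadicInterp_mem_Icc {f : ℝ → ℝ} (hf : Monotone f) (N : ℕ) (s : ℝ) :
    dyadicInterp f N s ∈ Icc (f (s - (1 / 2) ^ N)) (f (s + (1 / 2) ^ N)) := by
  have h2 : (0 : ℝ) < 2 ^ N := by positivity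
  have h1 := Int.le_ceil (s * 2 ^ N)
  have h3 := Int.ceil_lt_add_one (s * 2 ^ N)
  obtain ⟨hl, hr⟩ := dyadicInterp_mem_Icc_grid hf N s
  have he : (1 / 2 : ℝ) ^ N = 1 / 2 ^ N := by rw [div_pow, one_pow]
  refine ⟨(hf ?_).trans hl, hr.trans (hf ?_)⟩
  · rw [he, le_div_iff₀ h2, sub_mul, one_div_mul_cancel h2.ne']
    linarith
  · rw [he, div_le_iff₀ h2, add_mul, one_div_mul_cancel h2.ne']
    linarith

theorem monotone_dyadicInterp {f : ℝ → ℝ} (hf : Monotone f) (N : ℕ) :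
    Monotone (dyadicInterp f N) := by
  intro s t hst
  have h2 : (0 : ℝ) < 2 ^ N := by positivity
  have hk : ⌈s * 2 ^ N⌉ ≤ ⌈t * 2 ^ N⌉ := Int.ceil_mono (by gcongr)
  rcases hk.eq_or_lt with h | h
  · have hab : f ((((⌈t * 2 ^ N⌉ : ℤ) : ℝ) - 1) / 2 ^ N) ≤ f (((⌈t * 2 ^ N⌉ : ℤ) : ℝ) / 2 ^ N) :=
      hf (by gcongr; linarith)
    have hst' : s * 2 ^ N ≤ t * 2 ^ N := by gcongr
    unfold dyadicInterp
    rw [h]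
    generalize ((⌈t * 2 ^ N⌉ : ℤ) : ℝ) = k at *
    have hθ (s : ℝ) : (k / 2 ^ N - s) * 2 ^ N = k - s * 2 ^ N := by field_simp
    rw [hθ, hθ]
    nlinarith
  · refine (dyadicInterp_mem_Icc_grid hf N s).2.trans
      (le_trans (hf ?_) (dyadicInterp_mem_Icc_grid hf N t).1)
    have : ((⌈s * 2 ^ N⌉ : ℤ) : ℝ) + 1 ≤ ((⌈t * 2 ^ N⌉ : ℤ) : ℝ) := by exact_mod_cast h
    gcongr
    linarith

theorem tendsto_dyadicInterp_atTop {f : ℝ → ℝ} (hf : Monotone f) (ht : Tendsto f atTop atTop)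
    (N : ℕ) : Tendsto (dyadicInterp f N) atTop atTop :=
  tendsto_atTop_mono (fun s => (dyadicInterp_mem_Icc hf N s).1)
    (ht.comp (tendsto_atTop_add_const_right _ (-(1 / 2 : ℝ) ^ N) tendsto_id))

theorem tendsto_dyadicInterp_atBot {f : ℝ → ℝ} (hf : Monotone f) (hb : Tendsto f atBot atBot)
    (N : ℕ) : Tendsto (dyadicInterp f N) atBot atBot :=
  tendsto_atBot_mono (fun s => (dyadicInterp_mem_Icc hf N s).2)
    (hb.comp (tendsto_atBot_add_const_right _ ((1 / 2 : ℝ) ^ N) tendsto_id))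

theorem nonempty_setOf_le_of_tendsto_atTop {f : ℝ → ℝ} (ht : Tendsto f atTop atTop) (x : ℝ) :
    {t : ℝ | x ≤ f t}.Nonempty :=
  (ht.eventually_ge_atTop x).exists

theorem bddBelow_setOf_le_of_tendsto_atBot {f : ℝ → ℝ} (hb : Tendsto f atBot atBot) (x : ℝ) :
    BddBelow {t : ℝ | x ≤ f t} := by
  obtain ⟨a, ha⟩ := eventually_atBot.1 (hb.eventually_lt_atBot x)
  exact ⟨a, fun t ht => le_of_not_ge fun h => (ha t h).not_ge ht⟩

theorem geninv_lt_iff {f : ℝ → ℝ} (hf : Monotone f) (ht : Tendsto f atTop atTop)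
    (hb : Tendsto f atBot atBot) {x a : ℝ} :
    geninv f x < a ↔ ∃ r : ℚ, (r : ℝ) < a ∧ x ≤ f r := by
  unfold geninv
  rw [csInf_lt_iff (bddBelow_setOf_le_of_tendsto_atBot hb x)
    (nonempty_setOf_le_of_tendsto_atTop ht x)]
  constructor
  · rintro ⟨t, hxt, hta⟩
    obtain ⟨r, htr, hra⟩ := exists_rat_btwn hta
    exact ⟨r, hra, le_trans hxt (hf htr.le)⟩
  · rintro ⟨r, hra, hxr⟩
    exact ⟨r, hxr, hra⟩

/-- A comparison `f (t - δ) ≤ g t ≤ f (t + δ)` makes the generalized inverses `δ`-close. -/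
theorem abs_geninv_sub_geninv_le {f g : ℝ → ℝ} {δ : ℝ}
    (hft : Tendsto f atTop atTop) (hfb : Tendsto f atBot atBot)
    (hgt : Tendsto g atTop atTop) (hgb : Tendsto g atBot atBot)
    (h : ∀ t, g t ∈ Icc (f (t - δ)) (f (t + δ))) (x : ℝ) :
    |geninv g x - geninv f x| ≤ δ := by
  rw [abs_sub_le_iff]
  constructor
  · rw [sub_le_comm]
    refine le_csInf (nonempty_setOf_le_of_tendsto_atTop hft x) fun t hxt => ?_
    have : geninv g x ≤ t + δ := by
      refine csInf_le (bddBelow_setOf_le_of_tendsto_atBot hgb x) (?_ : x ≤ g (t + δ))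
      exact le_trans hxt (by simpa using (h (t + δ)).1)
    linarith
  · rw [sub_le_comm]
    refine le_csInf (nonempty_setOf_le_of_tendsto_atTop hgt x) fun t hxt => ?_
    have : geninv f x ≤ t + δ :=
      csInf_le (bddBelow_setOf_le_of_tendsto_atBot hfb x) (le_trans hxt (h t).2)
    linarith

/-- Convergence of the interpolated flow at every point where the limit path is continuous. -/
theorem tendsto_dyadicInterp_geninv {f : ℝ → ℝ} (hf : Monotone f)
    (ht : Tendsto f atTop atTop) (hb : Tendsto f atBot atBot) {x t : ℝ}
    (hc : ContinuousAt f (geninv f x - t)) :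
    Tendsto (fun N : ℕ => dyadicInterp f N (geninv (dyadicInterp f N) x - t)) atTop
      (𝓝 (f (geninv f x - t))) := by
  have hδ : Tendsto (fun N : ℕ => 2 * (1 / 2 : ℝ) ^ N) atTop (𝓝 0) := by
    simpa using (tendsto_pow_atTop_nhds_zero_of_lt_one (r := (1 / 2 : ℝ))
      (by norm_num) (by norm_num)).const_mul 2
  have hl : Tendsto (fun N : ℕ => geninv f x - t - 2 * (1 / 2 : ℝ) ^ N) atTop
      (𝓝 (geninv f x - t)) := by simpa using hδ.const_sub (geninv f x - t)
  have hr : Tendsto (fun N : ℕ => geninv f x - t + 2 * (1 / 2 : ℝ) ^ N) atTop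
      (𝓝 (geninv f x - t)) := by simpa using hδ.const_add (geninv f x - t)
  have hg (N : ℕ) := abs_sub_le_iff.1 (abs_geninv_sub_geninv_le ht hb
    (tendsto_dyadicInterp_atTop hf ht N) (tendsto_dyadicInterp_atBot hf hb N)
    (dyadicInterp_mem_Icc hf N) x)
  refine tendsto_of_tendsto_of_tendsto_of_le_of_le (hc.tendsto.comp hl) (hc.tendsto.comp hr)
    (fun N => le_trans (hf ?_) (dyadicInterp_mem_Icc hf N _).1)
    (fun N => le_trans (dyadicInterp_mem_Icc hf N _).2 (hf ?_))
  · linarith [(hg N).2]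
  · linarith [(hg N).1]

theorem ae_continuousAt_geninv_sub {f : ℝ → ℝ} (hf : Monotone f) (x : ℝ) :
    ∀ᵐ t : ℝ, ContinuousAt f (geninv f x - t) := by
  have : {t : ℝ | ¬ ContinuousAt f (geninv f x - t)}.Countable :=
    hf.countable_not_continuousAt.preimage (sub_right_injective (b := geninv f x))
  exact this.measure_zero volume

section RandomPaths

variable {Ω : Type*} [MeasurableSpace Ω]

theorem measurable_dyadicInterp {X : Ω × ℝ → ℝ} (hX : Measurable X) (N : ℕ) :
    Measurable fun q : Ω × ℝ => dyadicInterp (fun s => X (q.1, s)) N q.2 := by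
  have hk : Measurable fun q : Ω × ℝ => ((⌈q.2 * 2 ^ N⌉ : ℤ) : ℝ) := by fun_prop
  unfold dyadicInterp
  fun_prop

theorem measurable_geninv {X : Ω × ℝ → ℝ} (hX : Measurable X)
    (hm : ∀ ω, Monotone fun t => X (ω, t))
    (ht : ∀ ω, Tendsto (fun t => X (ω, t)) atTop atTop)
    (hb : ∀ ω, Tendsto (fun t => X (ω, t)) atBot atBot) :
    Measurable fun q : Ω × ℝ => geninv (fun s => X (q.1, s)) q.2 := by
  refine measurable_of_Iio fun a => ?_
  have : (fun q : Ω × ℝ => geninv (fun s => X (q.1, s)) q.2) ⁻¹' Iio a =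
      ⋃ r : ℚ, {q | (r : ℝ) < a ∧ q.2 ≤ X (q.1, (r : ℝ))} := by
    ext q
    simp [geninv_lt_iff (hm q.1) (ht q.1) (hb q.1)]
  rw [this]
  exact MeasurableSet.iUnion fun r =>
    (MeasurableSet.const _).inter (measurableSet_le measurable_snd
      (hX.comp (measurable_fst.prodMk measurable_const)))

theorem measurable_flow {X : Ω × ℝ → ℝ} (hX : Measurable X)
    (hm : ∀ ω, Monotone fun t => X (ω, t))
    (ht : ∀ ω, Tendsto (fun t => X (ω, t)) atTop atTop)
    (hb : ∀ ω, Tendsto (fun t => X (ω, t)) atBot atBot) :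
    Measurable fun q : Ω × (ℝ × ℝ) =>
      X (q.1, geninv (fun s => X (q.1, s)) q.2.1 - q.2.2) := by
  have hg := (measurable_geninv hX hm ht hb).comp
    (measurable_fst.prodMk (measurable_fst.comp measurable_snd) :
      Measurable fun q : Ω × (ℝ × ℝ) => (q.1, q.2.1))
  exact hX.comp (measurable_fst.prodMk (hg.sub (measurable_snd.comp measurable_snd)))

theorem measurable_dyadicInterp_flow {X : Ω × ℝ → ℝ} (hX : Measurable X)
    (hm : ∀ ω, Monotone fun t => X (ω, t))
    (ht : ∀ ω, Tendsto (fun t => X (ω, t)) atTop atTop)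
    (hb : ∀ ω, Tendsto (fun t => X (ω, t)) atBot atBot) (N : ℕ) :
    Measurable fun q : Ω × (ℝ × ℝ) =>
      dyadicInterp (fun s => X (q.1, s)) N
        (geninv (dyadicInterp (fun s => X (q.1, s)) N) q.2.1 - q.2.2) :=
  measurable_flow (measurable_dyadicInterp hX N)
    (fun ω => monotone_dyadicInterp (hm ω) N)
    (fun ω => tendsto_dyadicInterp_atTop (hm ω) (ht ω) N)
    (fun ω => tendsto_dyadicInterp_atBot (hm ω) (hb ω) N)

theorem ae_prod_tendsto_dyadicInterp_flow (P : Measure Ω) [SFinite P]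
    {X : Ω × ℝ → ℝ} (hX : Measurable X)
    (hm : ∀ ω, Monotone fun t => X (ω, t))
    (ht : ∀ ω, Tendsto (fun t => X (ω, t)) atTop atTop)
    (hb : ∀ ω, Tendsto (fun t => X (ω, t)) atBot atBot) :
    ∀ᵐ q : Ω × (ℝ × ℝ) ∂(P.prod volume),
      Tendsto (fun N : ℕ => dyadicInterp (fun s => X (q.1, s)) N
          (geninv (dyadicInterp (fun s => X (q.1, s)) N) q.2.1 - q.2.2)) atTop
        (𝓝 (X (q.1, geninv (fun s => X (q.1, s)) q.2.1 - q.2.2))) := by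
  have hS := measurableSet_tendsto_fun (l := atTop)
    (measurable_dyadicInterp_flow hX hm ht hb) (measurable_flow hX hm ht hb)
  refine (Measure.ae_prod_iff_ae_ae hS).2 (ae_of_all _ fun ω => ?_)
  refine (Measure.ae_prod_iff_ae_ae (measurable_prodMk_left hS)).2 (ae_of_all _ fun x => ?_)
  filter_upwards [ae_continuousAt_geninv_sub (hm ω) x] with t hc
  exact tendsto_dyadicInterp_geninv (hm ω) (ht ω) (hb ω) hc

/-- A jointly measurable process with almost surely monotone, unbounded paths agrees almost surely
with one all of whose paths have these properties. -/
theorem exists_modification_monotone (P : Measure Ω) {X : Ω × ℝ → ℝ} (hX : Measurable X)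
    (h : ∀ᵐ ω ∂P, Monotone (fun t => X (ω, t)) ∧
      Tendsto (fun t => X (ω, t)) atTop atTop ∧ Tendsto (fun t => X (ω, t)) atBot atBot) :
    ∃ Y : Ω × ℝ → ℝ, Measurable Y ∧ (∀ ω, Monotone fun t => Y (ω, t)) ∧
      (∀ ω, Tendsto (fun t => Y (ω, t)) atTop atTop) ∧
      (∀ ω, Tendsto (fun t => Y (ω, t)) atBot atBot) ∧
      ∀ᵐ ω ∂P, ∀ t, X (ω, t) = Y (ω, t) := by
  classical
  obtain ⟨S, hS, hSm, hSP⟩ := exists_measurable_superset_of_null (ae_iff.1 h)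
  have hgood (ω : Ω) (hω : ω ∉ S) := not_not.1 fun hn => hω (hS hn)
  refine ⟨fun q => if q.1 ∈ S then q.2 else X q,
    Measurable.ite (measurable_fst hSm) measurable_snd hX, fun ω => ?_, fun ω => ?_,
    fun ω => ?_, ?_⟩
  · by_cases hω : ω ∈ S
    · simp only [hω, if_true]
      exact monotone_id
    · simpa [hω] using (hgood ω hω).1
  · by_cases hω : ω ∈ S
    · simp only [hω, if_true]
      exact tendsto_id
    · simpa [hω] using (hgood ω hω).2.1
  · by_cases hω : ω ∈ S
    · simp only [hω, if_true]
      exact tendsto_id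
    · simpa [hω] using (hgood ω hω).2.2
  · filter_upwards [measure_eq_zero_iff_ae_notMem.1 hSP] with ω hω t
    simp [hω]

/-- Bounded almost everywhere convergence on a product with a finite measure implies convergence
of the expected `L^p` distance. -/
theorem tendsto_integral_rpow_integral_of_ae_prod {E : Type*} [MeasurableSpace E]
    (P : Measure Ω) [IsFiniteMeasure P] (ν : Measure E) [IsFiniteMeasure ν]
    {F : ℕ → Ω × E → ℝ} {B p : ℝ} (hp : 0 < p)
    (hF : ∀ N, AEStronglyMeasurable (F N) (P.prod ν)) (hB : ∀ N q, |F N q| ≤ B)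
    (hlim : ∀ᵐ q ∂(P.prod ν), Tendsto (fun N => F N q) atTop (𝓝 0)) :
    Tendsto (fun N => ∫ ω, (∫ e, |F N (ω, e)| ^ p ∂ν) ^ (1 / p) ∂P) atTop (𝓝 0) := by
  have hmeas (N : ℕ) : AEStronglyMeasurable (fun q => |F N q| ^ p) (P.prod ν) :=
    ((hF N).aemeasurable.abs.pow_const p).aestronglyMeasurable
  have hbd (N : ℕ) (q : Ω × E) : ‖|F N q| ^ p‖ ≤ B ^ p := by
    rw [Real.norm_of_nonneg (by positivity)]
    exact Real.rpow_le_rpow (abs_nonneg _) (hB N q) hp.le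
  have hnn (N : ℕ) (ω : Ω) : 0 ≤ ∫ e, |F N (ω, e)| ^ p ∂ν :=
    integral_nonneg fun e => by positivity
  have hinner (N : ℕ) (ω : Ω) :
      ∫ e, |F N (ω, e)| ^ p ∂ν ≤ B ^ p * ν.real univ :=
    (le_abs_self _).trans (norm_integral_le_of_norm_le_const (ae_of_all _ fun e => hbd N (ω, e)))
  have hmeas_outer (N : ℕ) : AEStronglyMeasurable
      (fun ω => (∫ e, |F N (ω, e)| ^ p ∂ν) ^ (1 / p)) P :=
    ((hmeas N).integral_prod_right'.aemeasurable.pow_const (1 / p)).aestronglyMeasurable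
  have key := tendsto_integral_of_dominated_convergence (μ := P) (f := fun _ => (0 : ℝ))
    (fun _ => (B ^ p * ν.real univ) ^ (1 / p)) hmeas_outer (integrable_const _)
    (fun N => ae_of_all _ fun ω => by
      rw [Real.norm_of_nonneg (Real.rpow_nonneg (hnn N ω) _)]
      exact Real.rpow_le_rpow (hnn N ω) (hinner N ω) (by positivity)) ?_
  · simpa using key
  · filter_upwards [Measure.ae_ae_of_ae_prod hlim,
      ae_all_iff.2 fun N => (hmeas N).prodMk_left] with ω hω hmω
    have h0 : Tendsto (fun N => ∫ e, |F N (ω, e)| ^ p ∂ν) atTop (𝓝 (∫ _, (0 : ℝ) ∂ν)) := by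
      refine tendsto_integral_of_dominated_convergence (fun _ => B ^ p) hmω (integrable_const _)
        (fun N => ae_of_all _ fun e => hbd N (ω, e)) ?_
      filter_upwards [hω] with e he
      simpa [Real.zero_rpow hp.ne'] using he.abs.rpow_const (Or.inr hp.le)
    rw [integral_zero] at h0
    have hp' : 0 < 1 / p := by positivity
    simpa [Real.zero_rpow hp.ne', Real.zero_rpow (inv_pos.2 hp).ne'] using
      h0.rpow_const (Or.inr hp'.le)

end RandomPaths

/-- the approximate solutions `U^{(N)}(ω;t,x) = u₀(Γ^{(N)}(ω;0;x,t))`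
converge to `U(ω;t,x) = u₀(Γ(ω;0;x,t))` pointwise `(P ⊗ λ)`-a.e. on `Ω × ℝ²`, and
`E^P[‖U^{(N)}(ω;·,·) - U(ω;·,·)‖_{L^p(K)}] → 0` as `N → ∞`. -/
theorem stmt12 {Ω : Type*} [MeasurableSpace Ω] (P : Measure Ω) [IsProbabilityMeasure P]
    (X : Ω × ℝ → ℝ) (hX : Measurable X)
    (hnice : ∀ᵐ ω ∂P,
      StrictMono (fun t => X (ω, t)) ∧
      (∀ s : ℝ, ContinuousWithinAt (fun t => X (ω, t)) (Set.Ici s) s) ∧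
      (∀ s : ℝ, ∃ L : ℝ, Tendsto (fun t => X (ω, t)) (𝓝[<] s) (𝓝 L)) ∧
      Tendsto (fun t => X (ω, t)) atTop atTop ∧
      Tendsto (fun t => X (ω, t)) atBot atBot)
    (u₀ : ℝ → ℝ) (hu₀c : Continuous u₀) (hu₀b : ∃ C : ℝ, ∀ y : ℝ, |u₀ y| ≤ C)
    (p : ℝ) (hp : 1 ≤ p) (K : Set (ℝ × ℝ)) (hK : IsCompact K) :
    (∀ᵐ q : Ω × (ℝ × ℝ) ∂(P.prod (volume : Measure (ℝ × ℝ))),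
      Tendsto
        (fun N : ℕ =>
          u₀ (dyadicInterp (fun s => X (q.1, s)) N
              (0 + geninv (dyadicInterp (fun s => X (q.1, s)) N) q.2.1 - q.2.2)))
        atTop
        (𝓝 (u₀ (X (q.1, 0 + geninv (fun s => X (q.1, s)) q.2.1 - q.2.2))))) ∧
    Tendsto
      (fun N : ℕ =>
        ∫ ω,
          (∫ q in K,
            |u₀ (dyadicInterp (fun s => X (ω, s)) N
                  (0 + geninv (dyadicInterp (fun s => X (ω, s)) N) q.1 - q.2))
                - u₀ (X (ω, 0 + geninv (fun s => X (ω, s)) q.1 - q.2))| ^ p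
            ∂(volume : Measure (ℝ × ℝ))) ^ (1 / p)
          ∂P)
      atTop (𝓝 0) := by
  obtain ⟨C, hC⟩ := hu₀b
  simp only [zero_add]
  obtain ⟨Y, hY, hYm, hYt, hYb, hXY⟩ := exists_modification_monotone P hX
    (hnice.mono fun ω h => ⟨h.1.monotone, h.2.2.2.1, h.2.2.2.2⟩)
  have hXYprod : ∀ᵐ q : Ω × (ℝ × ℝ) ∂(P.prod volume), ∀ t, X (q.1, t) = Y (q.1, t) :=
    Measure.quasiMeasurePreserving_fst.ae hXY
  have hlim : ∀ᵐ q : Ω × (ℝ × ℝ) ∂(P.prod volume), Tendsto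
      (fun N : ℕ => u₀ (dyadicInterp (fun s => X (q.1, s)) N
        (geninv (dyadicInterp (fun s => X (q.1, s)) N) q.2.1 - q.2.2))) atTop
      (𝓝 (u₀ (X (q.1, geninv (fun s => X (q.1, s)) q.2.1 - q.2.2)))) := by
    filter_upwards [ae_prod_tendsto_dyadicInterp_flow P hY hYm hYt hYb, hXYprod] with q hq hXq
    simp only [hXq]
    exact (hu₀c.tendsto _).comp hq
  refine ⟨hlim, ?_⟩
  have hac : P.prod (volume.restrict K) ≪ P.prod (volume : Measure (ℝ × ℝ)) :=
    Measure.AbsolutelyContinuous.rfl.prod Measure.restrict_le_self.absolutelyContinuous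
  have : IsFiniteMeasure ((volume : Measure (ℝ × ℝ)).restrict K) :=
    ⟨by simpa using hK.measure_lt_top⟩
  refine tendsto_integral_rpow_integral_of_ae_prod P (volume.restrict K) (B := C + C)
    (F := fun N q => u₀ (dyadicInterp (fun s => X (q.1, s)) N
        (geninv (dyadicInterp (fun s => X (q.1, s)) N) q.2.1 - q.2.2))
      - u₀ (X (q.1, geninv (fun s => X (q.1, s)) q.2.1 - q.2.2)))
    (by linarith) (fun N => ?_) (fun N q => ?_) ?_
  · have hm : Measurable fun q : Ω × (ℝ × ℝ) =>
        u₀ (dyadicInterp (fun s => Y (q.1, s)) N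
          (geninv (dyadicInterp (fun s => Y (q.1, s)) N) q.2.1 - q.2.2))
        - u₀ (Y (q.1, geninv (fun s => Y (q.1, s)) q.2.1 - q.2.2)) :=
      (hu₀c.measurable.comp (measurable_dyadicInterp_flow hY hYm hYt hYb N)).sub
        (hu₀c.measurable.comp (measurable_flow hY hYm hYt hYb))
    refine hm.aestronglyMeasurable.congr ?_
    filter_upwards [hac.ae_le hXYprod] with q hq
    simp only [hq]
  · exact (abs_sub _ _).trans (add_le_add (hC _) (hC _))
  · filter_upwards [hac.ae_le hlim] with q hq
    simpa using hq.sub_const (u₀ (X (q.1, geninv (fun s => X (q.1, s)) q.2.1 - q.2.2)))
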